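/- In the Grossman–Larson Hopf algebra ℚT of rooted trees, the elements κ_n = Σ_{t : |t| = n+1} t/|Sym(t)| (sum over all rooted trees with n+1 vertices), with κ_0 = •, form a sequence of divided powers: Δ(κ_n) = Σ_{i+j=n, i,j≥0} κ_i ⊗ κ_j, where Δ is the Grossman–Larson coproduct. -/

import Mathlib

/-! ### Planar rooted trees -/

/-- A planar rooted tree: a root with an ordered list of branches.
`PTree.node [T₁,…,T_k]` is `B₊(T₁⋯T_k)`; `PTree.node []` is the one-vertex tree `•`. -/
inductive PTree : Type where
  | node : List PTree → PTree

instance : Inhabited PTree := ⟨.node []⟩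

noncomputable instance : DecidableEq PTree := Classical.decEq _

/-- Number of vertices of a planar rooted tree. -/
def PTree.size : PTree → ℕ
  | .node l => 1 + (l.attach.map (fun x => PTree.size x.1)).sum
decreasing_by
  have h := List.sizeOf_lt_of_mem x.2
  simp only [PTree.node.sizeOf_spec]
  omega

/-! ### Rooted trees -/

/-- Isomorphism of the underlying rooted trees: the lists of branches agree
up to permutation and recursive isomorphism. -/
inductive PTree.Equiv : PTree → PTree → Prop where
  | node {l m m' : List PTree} :
      List.Forall₂ PTree.Equiv l m' → List.Perm m' m → PTree.Equiv (.node l) (.node m)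

/-- Rooted trees: planar rooted trees modulo isomorphism. -/
def RTree : Type := Quot PTree.Equiv

/-- The underlying rooted tree of a planar rooted tree. -/
def toR : PTree → RTree := Quot.mk _

/-- A choice of planar representative of a rooted tree. -/
noncomputable def RTree.out : RTree → PTree := Quot.out

noncomputable instance : DecidableEq RTree := Classical.decEq _

/-- The order of the symmetry group of (the underlying rooted tree of) a planar
rooted tree: `|Sym(B₊(t₁⋯t_k))| = (∏_s m_s!)·∏ᵢ |Sym(tᵢ)|`, where `m_s` is the
multiplicity of the isomorphism type `s` among the branches `t₁,…,t_k`. -/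
noncomputable def PTree.symOrder : PTree → ℕ
  | .node l =>
      (l.attach.map (fun x => PTree.symOrder x.1)).prod *
      (((l.map toR : List RTree) : Multiset RTree).toFinset.prod
        (fun s => (Multiset.count s (l.map toR : Multiset RTree)).factorial))
decreasing_by
  have h := List.sizeOf_lt_of_mem x.2
  simp only [PTree.node.sizeOf_spec]
  omega

/-- The order of the symmetry group of a rooted tree. -/
noncomputable def RTree.sym (t : RTree) : ℕ := t.out.symOrder

/-- Number of vertices of a rooted tree. -/
noncomputable def RTree.size (t : RTree) : ℕ := t.out.size

/-- `B₊` for rooted trees: attach a new root to a multiset forest. -/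
noncomputable def RTree.node (m : Multiset RTree) : RTree :=
  toR (PTree.node (m.toList.map RTree.out))

/-- The one-vertex rooted tree `•`. -/
noncomputable def RTree.bullet : RTree := toR (.node [])

/-! ### Enumeration of planar trees by size -/

mutual
/-- All planar rooted trees with exactly `n` vertices. -/
def treesOfSize : ℕ → List PTree
  | 0 => []
  | n + 1 => (forestsOfSize n).map PTree.node
  termination_by n => 2 * n
  decreasing_by omega
/-- All ordered forests of planar rooted trees with `n` vertices in total. -/
def forestsOfSize : ℕ → List (List PTree)
  | 0 => [[]]
  | n + 1 =>
      ((List.range (n + 1)).attach.map (fun j =>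
        (treesOfSize (j.1 + 1)).flatMap (fun t =>
          (forestsOfSize (n - j.1)).map (t :: ·)))).flatten
  termination_by n => 2 * n + 1
  decreasing_by
  · have hj := List.mem_range.mp j.2; omega
  · have hj := List.mem_range.mp j.2; omega
end

/-- All rooted trees with exactly `n` vertices. -/
noncomputable def allRTrees (n : ℕ) : List RTree := ((treesOfSize n).map toR).dedup

/-- `e(t)`: the number of planar rooted trees whose underlying rooted tree is `t`. -/
noncomputable def eCount (t : RTree) : ℕ :=
  ((treesOfSize t.size).filter (fun T => toR T = t)).length

/-! ### The Grossman–Larson coproduct -/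

/-- The Grossman–Larson coproduct of a planar representative:
`Δ(B₊(t₁⋯t_k)) = Σ_{I ⊔ J = {1,…,k}} B₊(t(I)) ⊗ B₊(t(J))`, the sum being over
ordered pairs of complementary subsets of `{1,…,k}`. Values are taken in the
model `(RTree × RTree) →₀ ℚ` of `ℚT ⊗ ℚT`. -/
noncomputable def glComulP (t : PTree) : (RTree × RTree) →₀ ℚ :=
  match t with
  | .node l =>
    (((List.replicate l.length [true, false]).sections).map (fun bs =>
      Finsupp.single
        (toR (.node ((l.zip bs).filterMap (fun x => if x.2 then some x.1 else none))),
         toR (.node ((l.zip bs).filterMap (fun x => if x.2 then none else some x.1))))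
        (1 : ℚ))).sum

/-- The Grossman–Larson coproduct of a rooted tree. -/
noncomputable def glComul (t : RTree) : (RTree × RTree) →₀ ℚ := glComulP t.out

/-- Linear extension of the Grossman–Larson coproduct to `ℚT`. -/
noncomputable def glComulF (f : RTree →₀ ℚ) : (RTree × RTree) →₀ ℚ :=
  f.sum (fun t a => a • glComul t)

/-- The tensor product of two elements of `ℚT`, in the model `(RTree × RTree) →₀ ℚ`
of `ℚT ⊗ ℚT`. -/
noncomputable def tensorF (f g : RTree →₀ ℚ) : (RTree × RTree) →₀ ℚ :=
  f.sum (fun a x => g.sum (fun b y => Finsupp.single (a, b) (x * y)))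

/-- `κ_n = Σ_{|t| = n+1} t / |Sym(t)|`, the sum over all rooted trees with `n+1`
vertices; in particular `κ_0 = •`. -/
noncomputable def kappa (n : ℕ) : RTree →₀ ℚ :=
  ((allRTrees (n + 1)).map (fun t => Finsupp.single t (((RTree.sym t : ℚ))⁻¹))).sum

/-! ### Products of factorials of multiplicities -/

namespace Multiset

variable {α : Type*} [DecidableEq α]

/-- The product of the factorials of the multiplicities of the elements of a multiset. -/
def countFactorial (s : Multiset α) : ℕ :=
  ∏ a ∈ s.toFinset, (s.count a).factorial

theorem countFactorial_ne_zero (s : Multiset α) : s.countFactorial ≠ 0 :=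
  Finset.prod_ne_zero_iff.mpr fun _ _ => Nat.factorial_ne_zero _

theorem countFactorial_cons (a : α) (s : Multiset α) :
    (a ::ₘ s).countFactorial = (s.count a + 1) * s.countFactorial := by
  have h : s.countFactorial = ∏ b ∈ (a ::ₘ s).toFinset, (s.count b).factorial := by
    refine Finset.prod_subset (by simp) fun b _ hb => ?_
    rw [Multiset.count_eq_zero_of_notMem (by simpa using hb), Nat.factorial_zero]
  have ha : a ∈ (a ::ₘ s).toFinset := by simp
  rw [h, countFactorial, ← Finset.mul_prod_erase _ _ ha, ← Finset.mul_prod_erase _ _ ha,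
    Multiset.count_cons_self, Nat.factorial_succ, mul_assoc]
  congr 2
  refine Finset.prod_congr rfl fun b hb => ?_
  rw [Multiset.count_cons_of_ne (Finset.ne_of_mem_erase hb)]

theorem count_map_prodMap_id_cons (a : α) (m : Multiset (Multiset α × Multiset α))
    (s t : Multiset α) :
    (m.map (Prod.map id (cons a))).count (s, t) =
      if a ∈ t then m.count (s, t.erase a) else 0 := by
  have hinj : Function.Injective (Prod.map id (cons a) : _ → Multiset α × Multiset α) :=
    Function.injective_id.prodMap fun _ _ h => (Multiset.cons_inj_right a).mp h
  split_ifs with h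
  · conv_lhs => rw [← Multiset.cons_erase h]
    exact Multiset.count_map_eq_count' _ m hinj (s, t.erase a)
  · refine Multiset.count_eq_zero_of_notMem fun hm => h ?_
    obtain ⟨p, -, hp⟩ := Multiset.mem_map.mp hm
    obtain ⟨-, rfl⟩ := Prod.ext_iff.mp hp
    simp

theorem count_map_prodMap_cons_id (a : α) (m : Multiset (Multiset α × Multiset α))
    (s t : Multiset α) :
    (m.map (Prod.map (cons a) id)).count (s, t) =
      if a ∈ s then m.count (s.erase a, t) else 0 := by
  have hinj : Function.Injective (Prod.map (cons a) id : _ → Multiset α × Multiset α) :=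
    Function.Injective.prodMap (fun _ _ h => (Multiset.cons_inj_right a).mp h)
      Function.injective_id
  split_ifs with h
  · conv_lhs => rw [← Multiset.cons_erase h]
    exact Multiset.count_map_eq_count' _ m hinj (s.erase a, t)
  · refine Multiset.count_eq_zero_of_notMem fun hm => h ?_
    obtain ⟨p, -, hp⟩ := Multiset.mem_map.mp hm
    obtain ⟨rfl, -⟩ := Prod.ext_iff.mp hp
    simp

theorem count_antidiagonal_mul_countFactorial (u : Multiset α) :
    ∀ s t : Multiset α, s + t = u →
      u.antidiagonal.count (s, t) * (s.countFactorial * t.countFactorial) =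
        u.countFactorial := by
  induction u using Multiset.induction_on with
  | empty =>
    intro s t h
    obtain ⟨rfl, rfl⟩ := add_eq_zero.mp h
    simp [countFactorial]
  | cons a u ih =>
    intro s t h
    have hcount : u.count a + 1 = s.count a + t.count a := by
      rw [← Multiset.count_add, h, Multiset.count_cons_self]
    have hs : (if a ∈ s then u.antidiagonal.count (s.erase a, t) else 0) *
        (s.countFactorial * t.countFactorial) = s.count a * u.countFactorial := by
      split_ifs with ha
      · obtain ⟨s, rfl⟩ := Multiset.exists_cons_of_mem ha
        rw [Multiset.cons_add, Multiset.cons_inj_right] at h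
        rw [Multiset.erase_cons_head, countFactorial_cons, Multiset.count_cons_self,
          ← ih s t h]
        ring
      · simp [Multiset.count_eq_zero_of_notMem ha]
    have ht : (if a ∈ t then u.antidiagonal.count (s, t.erase a) else 0) *
        (s.countFactorial * t.countFactorial) = t.count a * u.countFactorial := by
      split_ifs with ha
      · obtain ⟨t, rfl⟩ := Multiset.exists_cons_of_mem ha
        rw [Multiset.add_cons, Multiset.cons_inj_right] at h
        rw [Multiset.erase_cons_head, countFactorial_cons, Multiset.count_cons_self,
          ← ih s t h]
        ring
      · simp [Multiset.count_eq_zero_of_notMem ha]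
    rw [Multiset.antidiagonal_cons, Multiset.count_add, count_map_prodMap_id_cons,
      count_map_prodMap_cons_id, add_mul, hs, ht, countFactorial_cons, hcount]
    ring

end Multiset

/-! ### Rooted trees as multisets of rooted trees -/

theorem PTree.Equiv.rfl : ∀ T : PTree, PTree.Equiv T T
  | .node l => .node (List.forall₂_same.mpr fun x _ => PTree.Equiv.rfl x) (List.Perm.refl l)
decreasing_by
  have h := List.sizeOf_lt_of_mem ‹x ∈ l›
  simp only [PTree.node.sizeOf_spec]
  omega

theorem toR_out (t : RTree) : toR t.out = t := Quot.out_eq t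

theorem toR_node_perm {l m : List PTree} (h : l.Perm m) : toR (.node l) = toR (.node m) :=
  Quot.sound (.node (List.forall₂_same.mpr fun x _ => PTree.Equiv.rfl x) h)

theorem toR_node_cons_congr {T U : PTree} (h : toR T = toR U) (l : List PTree) :
    toR (.node (T :: l)) = toR (.node (U :: l)) :=
  congrArg (Quot.lift (fun T => toR (.node (T :: l))) fun _ _ hT =>
    Quot.sound (.node (.cons hT (List.forall₂_same.mpr fun x _ => PTree.Equiv.rfl x))
      (List.Perm.refl _))) h

theorem toR_node_append_congr {l m : List PTree}
    (h : List.Forall₂ (fun T U => toR T = toR U) l m) :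
    ∀ r : List PTree, toR (.node (l ++ r)) = toR (.node (m ++ r)) := by
  induction h with
  | nil => exact fun _ => rfl
  | @cons T U l m hT _ ih =>
    intro r
    calc toR (.node (T :: l ++ r)) = toR (.node (U :: (l ++ r))) := toR_node_cons_congr hT _
      _ = toR (.node (l ++ U :: r)) := toR_node_perm List.perm_middle.symm
      _ = toR (.node (m ++ U :: r)) := ih _
      _ = toR (.node (U :: m ++ r)) := toR_node_perm List.perm_middle

theorem toR_node_eq_of_perm_map {l m : List PTree} (h : (l.map toR).Perm (m.map toR)) :
    toR (.node l) = toR (.node m) := by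
  obtain ⟨k, hk, hkm⟩ : Relation.Comp (· = List.map toR ·) List.Perm (l.map toR) m := by
    rwa [List.eq_map_comp_perm]
  have hk' : List.Forall₂ (fun T U => toR T = toR U) l k := by
    rw [← List.forall₂_eq_eq_eq, List.forall₂_map_left_iff, List.forall₂_map_right_iff] at hk
    exact hk
  have := toR_node_append_congr hk' []
  rw [List.append_nil, List.append_nil] at this
  exact this.trans (toR_node_perm hkm)

/-- The multiset of branches of a rooted tree. -/
def RTree.branches : RTree → Multiset RTree :=
  Quot.lift (fun | .node l => (l.map toR : Multiset RTree)) <| by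
    rintro _ _ ⟨h, hp⟩
    refine Multiset.coe_eq_coe.mpr (List.Perm.trans (.of_eq ?_) (hp.map toR))
    rw [← List.forall₂_eq_eq_eq, List.forall₂_map_left_iff, List.forall₂_map_right_iff]
    exact h.imp fun _ _ => Quot.sound

theorem RTree.branches_toR_node (l : List PTree) :
    (toR (.node l)).branches = (l.map toR : Multiset RTree) := rfl

theorem RTree.branches_node (m : Multiset RTree) : (RTree.node m).branches = m := by
  have : toR ∘ RTree.out = id := funext toR_out
  rw [RTree.node, branches_toR_node, List.map_map, this, List.map_id, Multiset.coe_toList]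

theorem RTree.branches_injective : Function.Injective RTree.branches := by
  rintro ⟨⟨l⟩⟩ ⟨⟨m⟩⟩ h
  exact toR_node_eq_of_perm_map (Multiset.coe_eq_coe.mp h)

/-- A function of planar rooted trees computed from the multiset of its values on the branches
and the multiset of isomorphism types of the branches is an isomorphism invariant. -/
theorem PTree.apply_eq_apply_out {M : Type*} (f : PTree → M)
    (F : Multiset M → Multiset RTree → M)
    (hf : ∀ l : List PTree, f (.node l) = F (l.map f : Multiset M) (l.map toR : Multiset RTree)) :
    ∀ T U : PTree, toR T = toR U → f T = f U
  | .node l, .node m, h => by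
    have hp : (l.map toR : Multiset RTree) = (m.map toR : Multiset RTree) :=
      congrArg RTree.branches h
    have hl : ∀ x ∈ l, f x = f (toR x).out := fun x _ =>
      PTree.apply_eq_apply_out f F hf x _ (toR_out _).symm
    have hm : ∀ y ∈ m, f y = f (toR y).out := by
      intro y hy
      have : toR y ∈ (l.map toR : Multiset RTree) := by
        rw [hp]
        exact List.mem_map_of_mem hy
      obtain ⟨x, hx, hxy⟩ := List.mem_map.mp (Multiset.mem_coe.mp this)
      rw [← PTree.apply_eq_apply_out f F hf x y hxy, ← hxy]
      exact hl x hx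
    have hlm : (l.map f : Multiset M) = (m.map f : Multiset M) := by
      rw [List.map_congr_left hl, List.map_congr_left hm]
      have := congrArg (Multiset.map fun t => f t.out) hp
      simpa [Function.comp_def] using this
    rw [hf, hf, hp, hlm]
termination_by T => T
decreasing_by
  all_goals
    have h := List.sizeOf_lt_of_mem ‹x ∈ l›
    simp only [PTree.node.sizeOf_spec]
    omega

theorem PTree.size_node (l : List PTree) : (PTree.node l).size = 1 + (l.map PTree.size).sum := by
  rw [PTree.size, List.attach_map_val]

theorem PTree.symOrder_node (l : List PTree) :
    (PTree.node l).symOrder =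
      (l.map PTree.symOrder).prod * (l.map toR : Multiset RTree).countFactorial := by
  rw [PTree.symOrder, List.attach_map_val, Multiset.countFactorial]

theorem RTree.size_toR (T : PTree) : (toR T).size = T.size :=
  PTree.apply_eq_apply_out PTree.size (fun s _ => 1 + s.sum)
    (fun l => by rw [PTree.size_node, Multiset.sum_coe]) _ _ (toR_out _)

theorem RTree.sym_toR (T : PTree) : (toR T).sym = T.symOrder :=
  PTree.apply_eq_apply_out PTree.symOrder (fun s t => s.prod * t.countFactorial)
    (fun l => by rw [PTree.symOrder_node, Multiset.prod_coe]) _ _ (toR_out _)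

theorem RTree.size_eq (t : RTree) : t.size = 1 + (t.branches.map RTree.size).sum := by
  obtain ⟨⟨l⟩⟩ := t
  change (toR (.node l)).size = 1 + ((toR (.node l)).branches.map RTree.size).sum
  simp [size_toR, PTree.size_node, branches_toR_node, Function.comp_def]

theorem RTree.sym_eq (t : RTree) :
    t.sym = (t.branches.map RTree.sym).prod * t.branches.countFactorial := by
  obtain ⟨⟨l⟩⟩ := t
  change (toR (.node l)).sym =
    ((toR (.node l)).branches.map RTree.sym).prod * (toR (.node l)).branches.countFactorial
  simp [sym_toR, PTree.symOrder_node, branches_toR_node, Function.comp_def]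

theorem PTree.symOrder_ne_zero : ∀ T : PTree, T.symOrder ≠ 0
  | .node l => by
    rw [PTree.symOrder_node]
    refine mul_ne_zero (List.prod_ne_zero fun h => ?_) (Multiset.countFactorial_ne_zero _)
    obtain ⟨x, hx, hx0⟩ := List.mem_map.mp h
    exact PTree.symOrder_ne_zero x hx0
decreasing_by
  have h := List.sizeOf_lt_of_mem hx
  simp only [PTree.node.sizeOf_spec]
  omega

theorem RTree.sym_ne_zero (t : RTree) : t.sym ≠ 0 := PTree.symOrder_ne_zero _

/-! ### Enumeration by size -/

theorem mem_treesOfSize_succ_iff {n : ℕ}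
    (h : ∀ l : List PTree, l ∈ forestsOfSize n ↔ (l.map PTree.size).sum = n) (T : PTree) :
    T ∈ treesOfSize (n + 1) ↔ T.size = n + 1 := by
  obtain ⟨l⟩ := T
  rw [treesOfSize, PTree.size_node, List.mem_map]
  simp only [PTree.node.injEq, exists_eq_right, h]
  omega

theorem PTree.size_pos (T : PTree) : 0 < T.size := by
  obtain ⟨l⟩ := T
  rw [PTree.size_node]
  omega

theorem mem_forestsOfSize (n : ℕ) :
    ∀ l : List PTree, l ∈ forestsOfSize n ↔ (l.map PTree.size).sum = n := by
  induction n using Nat.strong_induction_on with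
  | _ n ih =>
    rintro (_ | ⟨T, l⟩)
    · cases n <;> simp [forestsOfSize]
    · have hT := T.size_pos
      cases n with
      | zero =>
        simp [forestsOfSize]
        omega
      | succ n =>
        have key : T :: l ∈ forestsOfSize (n + 1) ↔
            ∃ j < n + 1, T ∈ treesOfSize (j + 1) ∧ l ∈ forestsOfSize (n - j) := by
          rw [forestsOfSize]
          simp [List.mem_flatten]
        rw [key, List.map_cons, List.sum_cons]
        constructor
        · rintro ⟨j, hj, h₁, h₂⟩
          rw [mem_treesOfSize_succ_iff (ih j hj)] at h₁
          rw [ih _ (by omega)] at h₂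
          omega
        · intro h
          refine ⟨T.size - 1, by omega, ?_, ?_⟩
          · rw [mem_treesOfSize_succ_iff (ih _ (by omega))]
            omega
          · rw [ih _ (by omega)]
            omega

theorem mem_allRTrees_succ (n : ℕ) (t : RTree) : t ∈ allRTrees (n + 1) ↔ t.size = n + 1 := by
  simp only [allRTrees, List.mem_dedup, List.mem_map,
    mem_treesOfSize_succ_iff (mem_forestsOfSize n)]
  constructor
  · rintro ⟨T, hT, rfl⟩
    rw [RTree.size_toR, hT]
  · exact fun h => ⟨t.out, h, toR_out t⟩

theorem kappa_apply (n : ℕ) (t : RTree) :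
    kappa n t = if t.size = n + 1 then (t.sym : ℚ)⁻¹ else 0 := by
  have hnd : (allRTrees (n + 1)).Nodup := List.nodup_dedup _
  rw [kappa, ← List.sum_toFinset _ hnd, Finsupp.finsetSum_apply]
  simp [Finsupp.single_apply, mem_allRTrees_succ]

/-! ### The coproduct in coordinates -/

theorem sections_replicate_eq_antidiagonal (l : List PTree) :
    (((List.replicate l.length [true, false]).sections.map fun bs =>
      ((((l.zip bs).filterMap fun x => if x.2 then some x.1 else none).map toR :
          Multiset RTree),
        (((l.zip bs).filterMap fun x => if x.2 then none else some x.1).map toR :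
          Multiset RTree)) : List (Multiset RTree × Multiset RTree)) :
      Multiset (Multiset RTree × Multiset RTree)) =
    (l.map toR : Multiset RTree).antidiagonal := by
  induction l with
  | nil => simp
  | cons T l ih =>
    rw [List.map_cons, ← Multiset.cons_coe, Multiset.antidiagonal_cons, ← ih]
    simp only [List.length_cons, List.replicate_succ, List.sections, List.map_cons, List.map_nil,
      List.map_flatMap]
    rw [← Multiset.coe_bind]
    simp only [List.zip_cons_cons, List.filterMap_cons, if_true, Bool.false_eq_true, if_false,
      List.map_cons, ← Multiset.cons_coe, Multiset.coe_nil, ← Multiset.map_coe,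
      Multiset.bind_cons, Multiset.bind_zero, add_zero, Multiset.map_map]
    exact add_comm _ _

theorem glComul_apply (t a b : RTree) :
    glComul t (a, b) = t.branches.antidiagonal.count (a.branches, b.branches) := by
  obtain ⟨l, hl⟩ : ∃ l, t.out = .node l := by
    cases t.out with
    | node l => exact ⟨l, rfl⟩
  have ht : t.branches = (l.map toR : Multiset RTree) := by
    rw [← toR_out t, hl, RTree.branches_toR_node]
  rw [glComul, hl, ht, ← sections_replicate_eq_antidiagonal, glComulP]
  generalize (List.replicate l.length [true, false]).sections = L
  induction L with
  | nil => simp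
  | cons bs L ih =>
    rw [List.map_cons, List.sum_cons, Finsupp.add_apply, ih, List.map_cons,
      ← Multiset.cons_coe, Multiset.count_cons, Nat.cast_add, add_comm, Finsupp.single_apply]
    simp only [Prod.mk.injEq, @eq_comm RTree _ a, @eq_comm RTree _ b, ← RTree.branches_toR_node,
      RTree.branches_injective.eq_iff, Nat.cast_ite, Nat.cast_one, Nat.cast_zero]

theorem glComulF_apply (f : RTree →₀ ℚ) (p : RTree × RTree) :
    glComulF f p = f.sum fun t x => x * glComul t p := by
  rw [glComulF, Finsupp.sum_apply]
  rfl

theorem tensorF_apply (f g : RTree →₀ ℚ) (a b : RTree) : tensorF f g (a, b) = f a * g b := by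
  rw [tensorF, Finsupp.sum_apply, Finsupp.sum, Finset.sum_eq_single a]
  · rw [Finsupp.sum_apply, Finsupp.sum, Finset.sum_eq_single b]
    · rw [Finsupp.single_eq_same]
    · intro c _ hc
      rw [Finsupp.single_apply, if_neg (by simp [hc])]
    · intro h
      rw [Finsupp.notMem_support_iff.mp h, mul_zero, Finsupp.single_zero, Finsupp.zero_apply]
  · intro c _ hc
    rw [Finsupp.sum_apply, Finsupp.sum]
    exact Finset.sum_eq_zero fun d _ => by rw [Finsupp.single_apply, if_neg (by simp [hc])]
  · intro h
    rw [Finsupp.notMem_support_iff.mp h]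
    simp

/-- In the Grossman–Larson Hopf algebra `ℚT`, the elements
`κ_n = Σ_{|t|=n+1} t/|Sym(t)|` form a sequence of divided powers:
`Δ(κ_n) = Σ_{i+j=n} κ_i ⊗ κ_j`. -/
theorem kappa_divided_powers (n : ℕ) :
    glComulF (kappa n)
      = ∑ i ∈ Finset.range (n + 1), tensorF (kappa i) (kappa (n - i)) := by
  ext ⟨a, b⟩
  have hcount := Multiset.count_antidiagonal_mul_countFactorial _ a.branches b.branches rfl
  have hsize : (RTree.node (a.branches + b.branches)).size + 1 = a.size + b.size := by
    rw [RTree.size_eq, a.size_eq, b.size_eq, RTree.branches_node, Multiset.map_add,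
      Multiset.sum_add]
    omega
  have hsym : (a.branches + b.branches).antidiagonal.count (a.branches, b.branches) *
      (a.sym * b.sym) = (RTree.node (a.branches + b.branches)).sym := by
    rw [RTree.sym_eq (RTree.node _), a.sym_eq, b.sym_eq, RTree.branches_node, ← hcount,
      Multiset.map_add, Multiset.prod_add]
    ring
  set t := RTree.node (a.branches + b.branches) with ht
  have ha : (a.sym : ℚ) ≠ 0 := Nat.cast_ne_zero.mpr a.sym_ne_zero
  have hb : (b.sym : ℚ) ≠ 0 := Nat.cast_ne_zero.mpr b.sym_ne_zero
  have hpos (c : RTree) : 0 < c.size := c.out.size_pos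
  have hleft : glComulF (kappa n) (a, b) =
      if a.size + b.size = n + 2 then (a.sym : ℚ)⁻¹ * (b.sym : ℚ)⁻¹ else 0 := by
    rw [glComulF_apply, Finsupp.sum, Finset.sum_eq_single t]
    · rw [kappa_apply, glComul_apply, ht, RTree.branches_node, ← ht, ← hsize, ← hsym]
      have hne : t.sym ≠ 0 := t.sym_ne_zero
      rw [← hsym] at hne
      have hc := (Nat.cast_ne_zero (R := ℚ)).mpr (left_ne_zero_of_mul hne)
      push_cast
      split_ifs <;> first | omega | rw [zero_mul] | field_simp
    · intro s _ hs
      rw [glComul_apply, Multiset.count_eq_zero_of_notMem, Nat.cast_zero, mul_zero]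
      rw [Multiset.mem_antidiagonal]
      exact fun h => hs (RTree.branches_injective (by rw [← h, ht, RTree.branches_node]))
    · intro h
      rw [Finsupp.notMem_support_iff.mp h, zero_mul]
  rw [hleft, Finsupp.finsetSum_apply]
  simp only [tensorF_apply, kappa_apply]
  split_ifs with h
  · have := hpos a
    have := hpos b
    rw [Finset.sum_eq_single (a.size - 1)]
    · rw [if_pos (by omega), if_pos (by omega)]
    · intro i _ hi
      rw [if_neg (by omega), zero_mul]
    · intro hi
      simp only [Finset.mem_range] at hi
      omega
  · refine (Finset.sum_eq_zero fun i hi => ?_).symm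
    rw [Finset.mem_range] at hi
    split_ifs <;> first | omega | simp
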